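/- arXiv:2212.09959 — 2 statements merged into one kernel-verified Lean document; each statement's English description precedes it below -/
import Mathlib

section
/- For every w∈W with ℓ(w)=n and any two reduced words (i_1,…,i_n) and (j_1,…,j_n) of w, one has the equality of subsets of 𝔘(K): {i_1^{a_1}⋯i_n^{a_n} : (a_1,…,a_n)∈K^n} = {j_1^{a_1}⋯j_n^{a_n} : (a_1,…,a_n)∈K^n}; moreover the same equality holds with K^n replaced by K_+^n, where K_+ = K∩ℝ_{≥0}. -/
open FreeMonoid

/-- The minimum of two elements of an additive subgroup of `ℝ`
(the "sum" in the tropical semifield `K`). -/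
noncomputable def kmin {K : AddSubgroup ℝ} (a b : K) : K :=
  if (a : ℝ) ≤ (b : ℝ) then a else b

/-- Defining relations of the monoid `𝔘(K)` attached to a simply laced Coxeter matrix `M`
and the tropical semifield `K` (a subgroup of `(ℝ, +)` with sum `min` and product `+`). -/
inductive UKRel {I : Type*} (M : CoxeterMatrix I) (K : AddSubgroup ℝ) :
    FreeMonoid (I × K) → FreeMonoid (I × K) → Prop
  | comm (i j : I) (h : M i j = 2) (a b : K) :
      UKRel M K (of (i, a) * of (j, b)) (of (j, b) * of (i, a))
  | braid (i j : I) (h : M i j = 3) (a b c : K) :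
      UKRel M K (of (i, a) * of (j, b) * of (i, c))
        (of (j, b + c - kmin a c) * of (i, kmin a c) * of (j, a + b - kmin a c))
  | idem (i : I) (a b : K) :
      UKRel M K (of (i, a) * of (i, b)) (of (i, kmin a b))

/-- The monoid `𝔘(K)`. -/
noncomputable def UK {I : Type*} (M : CoxeterMatrix I) (K : AddSubgroup ℝ) :=
  (conGen (UKRel M K)).Quotient

noncomputable instance {I : Type*} (M : CoxeterMatrix I) (K : AddSubgroup ℝ) :
    Monoid (UK M K) := Con.monoid _

/-- The generator `i^a` of `𝔘(K)`. -/
noncomputable def genU {I : Type*} (M : CoxeterMatrix I) (K : AddSubgroup ℝ)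
    (i : I) (a : K) : UK M K :=
  (Con.mk' _) (of (i, a))

/-- The product `i₁^{a₁} ⋯ i_n^{a_n}` in `𝔘(K)` associated to a list of pairs. -/
noncomputable def prodU {I : Type*} (M : CoxeterMatrix I) (K : AddSubgroup ℝ)
    (ω : List (I × K)) : UK M K :=
  (ω.map fun p => genU M K p.1 p.2).prod

/-- `l` is a reduced word of `w`. -/
def IsRedWord {I W : Type*} [Group W] {M : CoxeterMatrix I} (cs : CoxeterSystem M W)
    (w : W) (l : List I) : Prop :=
  cs.wordProd l = w ∧ l.length = cs.length w

/-- The set `𝒰(K) = 𝔘_{w₀}(K)` of products over reduced words of `w₀`. -/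
noncomputable def calU {I W : Type*} [Group W] (M : CoxeterMatrix I) (K : AddSubgroup ℝ)
    (cs : CoxeterSystem M W) (w₀ : W) : Set (UK M K) :=
  {u | ∃ ω : List (I × K), IsRedWord cs w₀ (ω.map Prod.fst) ∧ u = prodU M K ω}

/-- The set `𝒰(K₊)`: products over reduced words of `w₀` with coefficients in `K₊ = K ∩ ℝ≥0`. -/
noncomputable def calUplus {I W : Type*} [Group W] (M : CoxeterMatrix I) (K : AddSubgroup ℝ)
    (cs : CoxeterSystem M W) (w₀ : W) : Set (UK M K) :=
  {u | ∃ ω : List (I × K), IsRedWord cs w₀ (ω.map Prod.fst) ∧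
        (∀ p ∈ ω, 0 ≤ (p.2 : ℝ)) ∧ u = prodU M K ω}

/-- Two vertices of the graph on `𝒰(K)` are joined by an edge. -/
noncomputable def UEdge {I W : Type*} [Group W] (M : CoxeterMatrix I) (K : AddSubgroup ℝ)
    (cs : CoxeterSystem M W) (w₀ : W) (H H' : UK M K) : Prop :=
  H ≠ H' ∧ ∃ (i : I) (b b' : K) (ω : List (I × K)),
    IsRedWord cs w₀ (i :: ω.map Prod.fst) ∧
    H = genU M K i b * prodU M K ω ∧ H' = genU M K i b' * prodU M K ω

/-- `H` and `H'` are at distance `≤ k` in the graph on `𝒰(K)`. -/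
noncomputable def DistLE {I W : Type*} [Group W] (M : CoxeterMatrix I) (K : AddSubgroup ℝ)
    (cs : CoxeterSystem M W) (w₀ : W) (k : ℕ) (H H' : UK M K) : Prop :=
  ∃ f : ℕ → UK M K, f 0 = H ∧ f k = H' ∧ (∀ t ≤ k, f t ∈ calU M K cs w₀) ∧
    ∀ t < k, f t = f (t + 1) ∨ UEdge M K cs w₀ (f t) (f (t + 1))

open scoped Pointwise

namespace CoxeterMatrix

variable {I N : Type*} [Monoid N] {M : CoxeterMatrix I}

/-- A family of involutions satisfying the simply laced braid relations satisfies the Coxeter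
relations. -/
theorem isLiftable_of_simplyLaced (hM : ∀ i j : I, i ≠ j → M i j = 2 ∨ M i j = 3) {f : I → N}
    (hsq : ∀ i, f i * f i = 1)
    (hcomm : ∀ i j, M i j = 2 → f i * f j = f j * f i)
    (hbraid : ∀ i j, M i j = 3 → f i * f j * f i = f j * f i * f j) : M.IsLiftable f := by
  intro i j
  rcases eq_or_ne i j with rfl | hij
  · simp [hsq]
  · rcases hM i j hij with h | h
    · rw [h, pow_two]
      nth_rewrite 2 [hcomm i j h]
      rw [mul_assoc, ← mul_assoc (f j), hsq, one_mul, hsq]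
    · have h3 : (f i * f j) ^ 3 = (f i * f j * f i) * (f j * f i * f j) := by
        simp only [pow_succ, pow_zero, one_mul, mul_assoc]
      rw [h, h3, ← hbraid i j h]
      calc f i * f j * f i * (f i * f j * f i)
          = f i * (f j * (f i * f i) * f j) * f i := by simp only [mul_assoc]
        _ = 1 := by simp [hsq]

end CoxeterMatrix

namespace CoxeterSystem

variable {I W : Type*} [Group W] {M : CoxeterMatrix I} (cs : CoxeterSystem M W)

local prefix:100 "s" => cs.simple
local prefix:100 "π" => cs.wordProd
local prefix:100 "ℓ" => cs.length
local prefix:100 "ris" => cs.rightInvSeq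
local prefix:100 "lis" => cs.leftInvSeq

theorem simple_mul_simple_comm {i j : I} (h : M i j = 2) : s i * s j = s j * s i := by
  have := cs.simple_mul_simple_pow i j
  rw [h, pow_two, mul_eq_one_iff_eq_inv] at this
  simpa using this

theorem simple_braid_three {i j : I} (h : M i j = 3) :
    s i * s j * s i = s j * s i * s j := by
  have h3 := cs.simple_mul_simple_pow i j
  have : (s i * s j * s i) * (s j * s i * s j) = 1 := by
    rw [← h3, h]
    simp only [pow_succ, pow_zero, one_mul, mul_assoc]
  rw [mul_eq_one_iff_eq_inv] at this
  simpa [mul_assoc] using this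

section CartanAction

open Classical in
/-- The simply laced Cartan matrix. -/
noncomputable def cartanEntry (M : CoxeterMatrix I) (i k : I) : ℤ :=
  if i = k then 2 else if M i k = 3 then -1 else 0

/-- The action of a simple reflection on the dual of the root lattice. -/
noncomputable def dualReflection (M : CoxeterMatrix I) (i : I) : Function.End (I → ℤ) :=
  fun f k => f k - cartanEntry M i k * f i

theorem dualReflection_isLiftable (hM : ∀ i j : I, i ≠ j → M i j = 2 ∨ M i j = 3) :
    M.IsLiftable (dualReflection M) := by
  have hself : ∀ i, cartanEntry M i i = 2 := fun i => by simp [cartanEntry]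
  have htwo : ∀ i j, M i j = 2 → cartanEntry M i j = 0 := fun i j h => by
    have hij : i ≠ j := by rintro rfl; simp at h
    simp [cartanEntry, hij, h]
  have hthree : ∀ i j, M i j = 3 → cartanEntry M i j = -1 := fun i j h => by
    have hij : i ≠ j := by rintro rfl; simp at h
    simp [cartanEntry, hij, h]
  refine CoxeterMatrix.isLiftable_of_simplyLaced hM (fun i => ?_) (fun i j h => ?_)
    (fun i j h => ?_)
  · funext f k
    change dualReflection M i (dualReflection M i f) k = f k
    simp only [dualReflection, hself]
    ring
  · funext f k
    change dualReflection M i (dualReflection M j f) k = dualReflection M j (dualReflection M i f) k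
    simp only [dualReflection, htwo i j h, htwo j i (M.symmetric i j ▸ h)]
    ring
  · funext f k
    change dualReflection M i (dualReflection M j (dualReflection M i f)) k
      = dualReflection M j (dualReflection M i (dualReflection M j f)) k
    simp only [dualReflection, hself, hthree i j h, hthree j i (M.symmetric i j ▸ h)]
    ring

theorem simple_injective_of_simplyLaced (hM : ∀ i j : I, i ≠ j → M i j = 2 ∨ M i j = 3) :
    Function.Injective cs.simple := by
  classical
  intro i j hij
  by_contra hne
  have h := congrArg (cs.lift ⟨_, dualReflection_isLiftable hM⟩) hij
  rw [cs.lift_apply_simple, cs.lift_apply_simple] at h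
  have h' := congrFun (congrFun h (Pi.single i 1)) i
  simp [dualReflection, cartanEntry, Ne.symm hne] at h'

end CartanAction

section Exchange

open Classical in
/-- The action of a simple reflection on signed elements of `W`: conjugation, with a change of sign
at the reflection itself. -/
noncomputable def signedConj (i : I) : Function.End (W × ZMod 2) :=
  fun p => (s i * p.1 * s i, p.2 + if p.1 = s i then 1 else 0)

open Classical in
theorem signedConj_apply (i : I) (t : W) (e : ZMod 2) :
    cs.signedConj i (t, e) = (s i * t * s i, e + if t = s i then 1 else 0) := rfl

open Classical in
theorem signedConj_isLiftable (hM : ∀ i j : I, i ≠ j → M i j = 2 ∨ M i j = 3) :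
    M.IsLiftable cs.signedConj := by
  have hconj : ∀ (i : I) (t u : W), s i * t * s i = u ↔ t = s i * u * s i := by
    intro i t u
    constructor <;> rintro rfl <;> simp [mul_assoc]
  have hite : ∀ (i : I) (t u : W), (if s i * t * s i = u then 1 else 0 : ZMod 2) =
      if t = s i * u * s i then 1 else 0 := fun i t u => if_congr (hconj i t u) rfl rfl
  refine CoxeterMatrix.isLiftable_of_simplyLaced hM (fun i => ?_) (fun i j h => ?_)
    (fun i j h => ?_)
  · funext ⟨t, e⟩
    change cs.signedConj i (cs.signedConj i (t, e)) = (t, e)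
    simp only [signedConj_apply, hite]
    ext
    · simp [mul_assoc]
    · simp only [simple_mul_simple_self, one_mul, add_assoc, CharTwo.add_self_eq_zero, add_zero]
  · funext ⟨t, e⟩
    change cs.signedConj i (cs.signedConj j (t, e)) = cs.signedConj j (cs.signedConj i (t, e))
    have hc := cs.simple_mul_simple_comm h
    have h1 : s j * s i * s j = s i := by rw [← hc, mul_assoc]; simp
    have h2 : s i * s j * s i = s j := by rw [hc, mul_assoc]; simp
    simp only [signedConj_apply, hite, h1, h2]
    ext
    · change s i * (s j * t * s j) * s i = s j * (s i * t * s i) * s j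
      calc _ = (s i * s j) * t * (s j * s i) := by simp only [mul_assoc]
        _ = _ := by rw [← hc]; nth_rewrite 1 [hc]; simp only [mul_assoc]
    · ring
  · funext ⟨t, e⟩
    change cs.signedConj i (cs.signedConj j (cs.signedConj i (t, e)))
      = cs.signedConj j (cs.signedConj i (cs.signedConj j (t, e)))
    have hb := cs.simple_braid_three h
    have h1 : s i * (s j * s i * s j) * s i = s j := by rw [← hb]; simp [mul_assoc]
    have h2 : s j * (s j * s i * s j) * s j = s i := by simp [mul_assoc]
    simp only [signedConj_apply, hite, h1, h2, hb]
    ext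
    · change s i * (s j * (s i * t * s i) * s j) * s i = s j * (s i * (s j * t * s j) * s i) * s j
      calc _ = (s i * s j * s i) * t * (s i * s j * s i) := by simp only [mul_assoc]
        _ = _ := by rw [hb]; simp only [mul_assoc]
    · ring

open Classical in
theorem prod_map_signedConj (ω : List I) (t : W) (e : ZMod 2) :
    (ω.map cs.signedConj).prod (t, e) = (π ω * t * (π ω)⁻¹, e + ((ris ω).count t : ZMod 2)) := by
  induction ω with
  | nil => simp; rfl
  | cons i ω ih =>
    rw [List.map_cons, List.prod_cons]
    change cs.signedConj i ((ω.map cs.signedConj).prod (t, e)) = _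
    have hiff : π ω * t * (π ω)⁻¹ = s i ↔ (π ω)⁻¹ * s i * π ω = t := by
      constructor
      · intro h; rw [← h]; group
      · rintro rfl; group
    rw [ih, signedConj_apply, rightInvSeq, List.count_cons]
    ext
    · simp [wordProd_cons, mul_assoc]
    · simp [hiff, add_assoc, beq_iff_eq]

open Classical in
theorem count_leftInvSeq_eq_of_wordProd_eq (hM : ∀ i j : I, i ≠ j → M i j = 2 ∨ M i j = 3)
    {ω ω' : List I} (h : π ω = π ω') (t : W) :
    ((lis ω).count t : ZMod 2) = (lis ω').count t := by
  have key : ∀ ω : List I, ((ω.reverse.map cs.signedConj).prod) =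
      cs.lift ⟨_, cs.signedConj_isLiftable hM⟩ (π ω)⁻¹ := by
    intro ω
    rw [← wordProd_reverse, wordProd, map_list_prod, List.map_map]
    congr 2
    funext i
    simp
  have h' : ((ω.reverse.map cs.signedConj).prod) (t, 0) =
      ((ω'.reverse.map cs.signedConj).prod) (t, 0) := by rw [key, key, h]
  rw [prod_map_signedConj, prod_map_signedConj, rightInvSeq_reverse, rightInvSeq_reverse] at h'
  simpa using congrArg Prod.snd h'

/-- The exchange property for simply laced Coxeter systems. -/
theorem exists_eraseIdx_of_isLeftDescent (hM : ∀ i j : I, i ≠ j → M i j = 2 ∨ M i j = 3)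
    {ω : List I} {i : I} (hi : cs.IsLeftDescent (π ω) i) :
    ∃ k < ω.length, s i * π ω = π (ω.eraseIdx k) := by
  classical
  obtain ⟨v, hv, hvi⟩ := cs.exists_isReduced (s i * π ω)
  have hprod : π (i :: v) = π ω := by rw [wordProd_cons, ← hvi]; simp
  have hred : cs.IsReduced (i :: v) := by
    rw [isLeftDescent_iff] at hi
    rw [IsReduced, hprod, ← hi, hvi, hv.eq, List.length_cons]
  have hone : (lis (i :: v)).count (s i) = 1 :=
    List.count_eq_one_of_mem hred.nodup_leftInvSeq (by simp [leftInvSeq])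
  have hcount := cs.count_leftInvSeq_eq_of_wordProd_eq hM hprod (s i)
  have hmem : s i ∈ lis ω := by
    by_contra hn
    rw [hone, List.count_eq_zero_of_not_mem hn] at hcount
    simp at hcount
  obtain ⟨k, hk, hki⟩ := List.getElem_of_mem hmem
  refine ⟨k, by simpa using hk, ?_⟩
  rw [← cs.getD_leftInvSeq_mul_wordProd, List.getD_eq_getElem _ _ hk, hki]

end Exchange

section Matsumoto

theorem exists_eq_simple_mul_simple_mul (hM : ∀ i j : I, i ≠ j → M i j = 2 ∨ M i j = 3)
    {i j : I} (hij : i ≠ j) {w : W} (hi : cs.IsLeftDescent w i) (hj : cs.IsLeftDescent w j) :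
    ∃ v : List I, w = π (i :: j :: v) ∧ v.length + 2 = ℓ w := by
  obtain ⟨v, hv, hvj⟩ := cs.exists_isReduced (s j * w)
  have hprod : π (j :: v) = w := by rw [wordProd_cons, ← hvj]; simp
  rw [isLeftDescent_iff, hvj, hv.eq] at hj
  obtain ⟨k, hk, hkv⟩ := cs.exists_eraseIdx_of_isLeftDescent hM (hprod.symm ▸ hi)
  rw [hprod] at hkv
  cases k with
  | zero =>
    rw [List.eraseIdx_cons_zero, ← hvj] at hkv
    exact absurd (cs.simple_injective_of_simplyLaced hM (mul_right_cancel hkv)) hij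
  | succ k =>
    refine ⟨v.eraseIdx k, ?_, ?_⟩
    · rw [wordProd_cons, ← List.eraseIdx_cons_succ, ← hkv]; simp
    · have := List.length_eraseIdx_add_one (l := v) (i := k) (by simpa using hk)
      lia

theorem exists_eq_simple_mul_simple_mul_simple_mul
    (hM : ∀ i j : I, i ≠ j → M i j = 2 ∨ M i j = 3)
    {i j : I} (h : M i j = 3) {w : W} (hi : cs.IsLeftDescent w i) (hj : cs.IsLeftDescent w j) :
    ∃ v : List I, w = π (i :: j :: i :: v) ∧ v.length + 3 = ℓ w := by
  have hij : i ≠ j := by rintro rfl; simp at h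
  have hb := cs.simple_braid_three h
  obtain ⟨v, hv, hlen⟩ := cs.exists_eq_simple_mul_simple_mul hM hij hi hj
  obtain ⟨k, hk, hkv⟩ := cs.exists_eraseIdx_of_isLeftDescent hM (hv ▸ hj)
  rw [← hv] at hkv
  rcases k with _ | _ | k
  · rw [List.eraseIdx_cons_zero, wordProd_cons, mul_right_inj] at hkv
    have := cs.length_wordProd_le v
    rw [← hkv] at this
    lia
  · simp only [List.eraseIdx_cons_succ, List.eraseIdx_cons_zero] at hkv
    rw [hv, wordProd_cons, wordProd_cons, wordProd_cons, ← mul_assoc, ← mul_assoc,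
      mul_left_inj, ← hb, mul_assoc, mul_eq_left, mul_eq_one_iff_eq_inv] at hkv
    exact absurd (cs.simple_injective_of_simplyLaced hM (by simpa using hkv.symm)) hij
  · refine ⟨v.eraseIdx k, ?_, ?_⟩
    · simp only [List.eraseIdx_cons_succ, wordProd_cons] at hkv ⊢
      rw [← mul_assoc, ← mul_assoc, hb, mul_assoc, mul_assoc, ← hkv]
      simp
    · have := List.length_eraseIdx_add_one (l := v) (i := k) (by simpa using hk)
      lia

/-- Matsumoto's theorem for simply laced Coxeter systems. -/
theorem prod_map_eq_of_isReduced (hM : ∀ i j : I, i ≠ j → M i j = 2 ∨ M i j = 3)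
    {N : Type*} [Monoid N] {f : I → N}
    (hcomm : ∀ i j, M i j = 2 → f i * f j = f j * f i)
    (hbraid : ∀ i j, M i j = 3 → f i * f j * f i = f j * f i * f j)
    {l l' : List I} (hl : cs.IsReduced l) (hl' : cs.IsReduced l') (h : π l = π l') :
    (l.map f).prod = (l'.map f).prod := by
  induction hn : l.length using Nat.strong_induction_on generalizing l l' with
  | _ n ih =>
  have hlen : l.length = l'.length := by rw [← hl.eq, ← hl'.eq, h]
  match l, l' with
  | [], [] => rfl
  | [], _ :: _ => simp at hlen
  | _ :: _, [] => simp at hlen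
  | i :: u, j :: v =>
    have tail : ∀ {k x y}, cs.IsReduced (k :: x) → cs.IsReduced (k :: y) →
        π (k :: x) = π (k :: y) → x.length < n →
        ((k :: x).map f).prod = ((k :: y).map f).prod := by
      intro k x y hx hy hxy hlt
      rw [List.map_cons, List.map_cons, List.prod_cons, List.prod_cons]
      rw [wordProd_cons, wordProd_cons, mul_right_inj] at hxy
      rw [ih _ hlt (by simpa using hx.drop 1) (by simpa using hy.drop 1) hxy rfl]
    have desc : ∀ {k x}, cs.IsReduced (k :: x) → cs.IsLeftDescent (π (k :: x)) k := by
      intro k x hx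
      have := cs.length_wordProd_le x
      rw [IsLeftDescent, hx.eq, wordProd_cons]
      simp only [simple_mul_simple_cancel_left, List.length_cons]
      lia
    have hu : u.length < n := by simp at hn; lia
    have hv : v.length < n := by simp at hlen; lia
    rcases eq_or_ne i j with rfl | hij
    · exact tail hl hl' h hu
    have hi := desc hl
    have hj := desc hl'
    rw [← h] at hj
    rcases hM i j hij with hm | hm
    · obtain ⟨x, hx, hxl⟩ := cs.exists_eq_simple_mul_simple_mul hM hij hi hj
      have hx' : π (i :: u) = π (j :: i :: x) := by
        rw [hx]; simp only [wordProd_cons, ← mul_assoc, cs.simple_mul_simple_comm hm]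
      rw [tail hl (y := j :: x) (by rw [IsReduced, ← hx, ← hxl]; rfl) hx hu,
        tail hl' (y := i :: x) (by rw [IsReduced, ← hx', ← hxl]; rfl) (h ▸ hx') hv]
      simp only [List.map_cons, List.prod_cons, ← mul_assoc, hcomm i j hm]
    · obtain ⟨x, hx, hxl⟩ := cs.exists_eq_simple_mul_simple_mul_simple_mul hM hm hi hj
      have hx' : π (i :: u) = π (j :: i :: j :: x) := by
        rw [hx]; simp only [wordProd_cons, ← mul_assoc, cs.simple_braid_three hm]
      rw [tail hl (y := j :: i :: x) (by rw [IsReduced, ← hx, ← hxl]; rfl) hx hu,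
        tail hl' (y := i :: j :: x) (by rw [IsReduced, ← hx', ← hxl]; rfl) (h ▸ hx') hv]
      simp only [List.map_cons, List.prod_cons, ← mul_assoc, hbraid i j hm]

end Matsumoto

end CoxeterSystem

section UK

variable {I : Type*} {M : CoxeterMatrix I} {K : AddSubgroup ℝ}

theorem genU_comm {i j : I} (h : M i j = 2) (a b : K) :
    genU M K i a * genU M K j b = genU M K j b * genU M K i a :=
  (Con.eq _).2 (ConGen.Rel.of _ _ (UKRel.comm i j h a b))

theorem genU_braid {i j : I} (h : M i j = 3) (a b c : K) :
    genU M K i a * genU M K j b * genU M K i c =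
      genU M K j (b + c - kmin a c) * genU M K i (kmin a c) * genU M K j (a + b - kmin a c) :=
  (Con.eq _).2 (ConGen.Rel.of _ _ (UKRel.braid i j h a b c))

theorem setOf_prodU_zip_eq_prod (P : Set K) (l : List I) :
    {u | ∃ a : List K, a.length = l.length ∧ (∀ x ∈ a, x ∈ P) ∧ u = prodU M K (l.zip a)} =
      (l.map fun i => genU M K i '' P).prod := by
  induction l with
  | nil =>
    ext u
    simp [prodU]
  | cons i l ih =>
    rw [List.map_cons, List.prod_cons, ← ih]
    ext u
    simp only [Set.mem_ofPred_eq, Set.mem_mul, Set.mem_image]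
    constructor
    · rintro ⟨_ | ⟨x, a⟩, ha, hP, rfl⟩
      · simp at ha
      · rw [List.forall_mem_cons] at hP
        exact ⟨_, ⟨x, hP.1, rfl⟩, _, ⟨a, by simpa using ha, hP.2, rfl⟩, by simp [prodU]⟩
    · rintro ⟨_, ⟨x, hx, rfl⟩, _, ⟨a, ha, hP, rfl⟩, rfl⟩
      exact ⟨x :: a, by simpa using ha, List.forall_mem_cons.2 ⟨hx, hP⟩, by simp [prodU]⟩

theorem image_genU_comm (P : Set K) {i j : I} (h : M i j = 2) :
    genU M K i '' P * genU M K j '' P = genU M K j '' P * genU M K i '' P := by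
  rw [← Set.image2_mul, ← Set.image2_mul, Set.image2_image_left, Set.image2_image_right,
    Set.image2_image_left, Set.image2_image_right, Set.image2_swap]
  simp only [genU_comm h]

theorem image_genU_braid {P : Set K} (hmin : ∀ a ∈ P, ∀ c ∈ P, kmin a c ∈ P)
    (hsub : ∀ a ∈ P, ∀ b ∈ P, ∀ c ∈ P, a + b - kmin a c ∈ P ∧ b + c - kmin a c ∈ P)
    {i j : I} (h : M i j = 3) :
    genU M K i '' P * genU M K j '' P * genU M K i '' P =
      genU M K j '' P * genU M K i '' P * genU M K j '' P := by
  have key : ∀ i j : I, M i j = 3 → genU M K i '' P * genU M K j '' P * genU M K i '' P ⊆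
      genU M K j '' P * genU M K i '' P * genU M K j '' P := by
    rintro i j h _ ⟨_, ⟨_, ⟨a, ha, rfl⟩, _, ⟨b, hb, rfl⟩, rfl⟩, _, ⟨c, hc, rfl⟩, rfl⟩
    obtain ⟨h1, h2⟩ := hsub a ha b hb c hc
    beta_reduce
    rw [genU_braid h]
    exact Set.mul_mem_mul (Set.mul_mem_mul (Set.mem_image_of_mem _ h2)
      (Set.mem_image_of_mem _ (hmin a ha c hc))) (Set.mem_image_of_mem _ h1)
  exact (key i j h).antisymm (key j i (M.symmetric i j ▸ h))

end UK

/-- **Independence of the reduced word** (Lusztig, "Half circles on flag manifolds over a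
semifield", nos. 5, 9).  For `w ∈ W` with `ℓ(w) = n` and any two reduced words
`(i₁, …, i_n)`, `(j₁, …, j_n)` of `w`, the subsets
`{i₁^{a₁} ⋯ i_n^{a_n} : a ∈ K^n}` and `{j₁^{a₁} ⋯ j_n^{a_n} : a ∈ K^n}` of `𝔘(K)`
coincide, and likewise with `K` replaced by `K₊ = K ∩ ℝ≥0`. -/
theorem image_indep_of_redWord
    {I W : Type*} [Finite I] [Nonempty I] [Group W] [Finite W]
    (M : CoxeterMatrix I) (hM : ∀ i j : I, i ≠ j → M i j = 2 ∨ M i j = 3)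
    (cs : CoxeterSystem M W)
    (K : AddSubgroup ℝ) (hK : K ≠ ⊥)
    (w : W) (l l' : List I) (hl : IsRedWord cs w l) (hl' : IsRedWord cs w l') :
    ({u | ∃ a : List K, a.length = l.length ∧ u = prodU M K (l.zip a)} :
        Set (UK M K)) =
      {u | ∃ a : List K, a.length = l'.length ∧ u = prodU M K (l'.zip a)} ∧
    ({u | ∃ a : List K, a.length = l.length ∧ (∀ x ∈ a, 0 ≤ (x : ℝ)) ∧
          u = prodU M K (l.zip a)} : Set (UK M K)) =
      {u | ∃ a : List K, a.length = l'.length ∧ (∀ x ∈ a, 0 ≤ (x : ℝ)) ∧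
          u = prodU M K (l'.zip a)} := by
  have hred : ∀ {l}, IsRedWord cs w l → cs.IsReduced l := fun h => by
    rw [CoxeterSystem.IsReduced, h.1, h.2]
  have key : ∀ P : Set K, (∀ a ∈ P, ∀ c ∈ P, kmin a c ∈ P) →
      (∀ a ∈ P, ∀ b ∈ P, ∀ c ∈ P, a + b - kmin a c ∈ P ∧ b + c - kmin a c ∈ P) →
      {u | ∃ a : List K, a.length = l.length ∧ (∀ x ∈ a, x ∈ P) ∧ u = prodU M K (l.zip a)} =
      {u | ∃ a : List K, a.length = l'.length ∧ (∀ x ∈ a, x ∈ P) ∧ u = prodU M K (l'.zip a)} := by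
    intro P hmin hsub
    rw [setOf_prodU_zip_eq_prod, setOf_prodU_zip_eq_prod]
    exact cs.prod_map_eq_of_isReduced hM (fun _ _ => image_genU_comm P)
      (fun _ _ => image_genU_braid hmin hsub) (hred hl) (hred hl') (hl.1.trans hl'.1.symm)
  refine ⟨by simpa using key Set.univ, key {x | 0 ≤ (x : ℝ)} ?_ ?_⟩
  · intro a ha c hc
    unfold kmin
    split_ifs <;> assumption
  · intro a ha b hb c hc
    simp only [Set.mem_ofPred_eq] at ha hb hc ⊢
    unfold kmin
    split_ifs <;> push_cast <;> constructor <;> linarith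
end

section
/- Let w∈W with ℓ(w)=n. If (i_1,…,i_n) and (j_1,…,j_n) are reduced words of w, (a_1,…,a_n) and (b_1,…,b_n) are in K_+^n, and i_1^{a_1}⋯i_n^{a_n} = j_1^{b_1}⋯j_n^{b_n} in 𝔘(K), then the zero-subwords of the two representations are equal in 𝔘₁. Consequently there is a well-defined map χ_w from the set {i_1^{a_1}⋯i_n^{a_n} : (i_1,…,i_n) a reduced word of w, (a_1,…,a_n)∈K_+^n} to 𝔘₁, sending an element to the zero-subword of any of its representations. -/
open FreeMonoid

/-- Defining relations of the 0-Hecke monoid `𝔘₁` of a simply laced Coxeter matrix. -/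
inductive HeckeRel {I : Type*} (M : CoxeterMatrix I) : FreeMonoid I → FreeMonoid I → Prop
  | comm (i j : I) (h : M i j = 2) : HeckeRel M (of i * of j) (of j * of i)
  | braid (i j : I) (h : M i j = 3) : HeckeRel M (of i * of j * of i) (of j * of i * of j)
  | idem (i : I) : HeckeRel M (of i * of i) (of i)

/-- The 0-Hecke monoid `𝔘₁ = 𝔘({1})`. -/
def Hecke {I : Type*} (M : CoxeterMatrix I) := (conGen (HeckeRel M)).Quotient

instance {I : Type*} (M : CoxeterMatrix I) : Monoid (Hecke M) := Con.monoid _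

/-- The generator `g_i` of the 0-Hecke monoid. -/
def genH {I : Type*} (M : CoxeterMatrix I) (i : I) : Hecke M := (Con.mk' _) (of i)

/-- The product `g_{i₁} g_{i₂} ⋯ g_{i_n}` in the 0-Hecke monoid. -/
def prodH {I : Type*} (M : CoxeterMatrix I) (l : List I) : Hecke M :=
  (l.map fun i => genH M i).prod

/-- The list of indices (in order) whose coefficient vanishes, in a word in the
generators of `𝔘(K)`. -/
noncomputable def zeroList {I : Type*} {K : AddSubgroup ℝ} : List (I × K) → List I
  | [] => []
  | p :: rest => if (p.2 : ℝ) = 0 then p.1 :: zeroList rest else zeroList rest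

/-- The zero-subword of a representation `i₁^{a₁} ⋯ i_n^{a_n}`, as an element of the
0-Hecke monoid `𝔘₁`: the product `g_{i_{j₁}} ⋯ g_{i_{j_k}}` over the positions
`j₁ < ⋯ < j_k` where `a_j = 0`. -/
noncomputable def chiRep {I : Type*} (M : CoxeterMatrix I) {K : AddSubgroup ℝ}
    (ω : List (I × K)) : Hecke M :=
  prodH M (zeroList ω)

theorem genH_comm {I : Type*} {M : CoxeterMatrix I} {i j : I} (h : M i j = 2) :
    genH M i * genH M j = genH M j * genH M i :=
  (Con.eq _).2 (ConGen.Rel.of _ _ (HeckeRel.comm i j h))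

theorem genH_braid {I : Type*} {M : CoxeterMatrix I} {i j : I} (h : M i j = 3) :
    genH M i * genH M j * genH M i = genH M j * genH M i * genH M j :=
  (Con.eq _).2 (ConGen.Rel.of _ _ (HeckeRel.braid i j h))

theorem genH_idem {I : Type*} (M : CoxeterMatrix I) (i : I) :
    genH M i * genH M i = genH M i :=
  (Con.eq _).2 (ConGen.Rel.of _ _ (HeckeRel.idem i))

theorem coe_kmin {K : AddSubgroup ℝ} (a b : K) : ((kmin a b : K) : ℝ) = min (a : ℝ) b := by
  unfold kmin
  split_ifs with h
  · exact (min_eq_left h).symm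
  · exact (min_eq_right (le_of_not_ge h)).symm

/-- The weight of `i^a`: `g_i` if `a = 0`, trivial if `a > 0`, and absorbing if `a < 0`. -/
noncomputable def zeroWeight {I : Type*} (M : CoxeterMatrix I) (i : I) (a : ℝ) :
    WithZero (Hecke M) :=
  if a < 0 then 0 else if a = 0 then (genH M i : WithZero (Hecke M)) else 1

theorem zeroWeight_of_neg {I : Type*} (M : CoxeterMatrix I) (i : I) {a : ℝ} (h : a < 0) :
    zeroWeight M i a = 0 := if_pos h

theorem zeroWeight_zero {I : Type*} (M : CoxeterMatrix I) (i : I) :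
    zeroWeight M i 0 = (genH M i : WithZero (Hecke M)) := by
  simp [zeroWeight]

theorem zeroWeight_of_pos {I : Type*} (M : CoxeterMatrix I) (i : I) {a : ℝ} (h : 0 < a) :
    zeroWeight M i a = 1 := by
  simp [zeroWeight, h.not_gt, h.ne']

theorem zeroWeight_comm {I : Type*} {M : CoxeterMatrix I} {i j : I} (h : M i j = 2) (a b : ℝ) :
    zeroWeight M i a * zeroWeight M j b = zeroWeight M j b * zeroWeight M i a := by
  unfold zeroWeight
  split_ifs <;> simp [← WithZero.coe_mul, genH_comm h]

theorem zeroWeight_idem {I : Type*} (M : CoxeterMatrix I) (i : I) (a b : ℝ) :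
    zeroWeight M i a * zeroWeight M i b = zeroWeight M i (min a b) := by
  wlog hab : a ≤ b generalizing a b
  · have hc : zeroWeight M i a * zeroWeight M i b = zeroWeight M i b * zeroWeight M i a := by
      unfold zeroWeight
      split_ifs <;> simp
    rw [hc, min_comm]
    exact this b a (le_of_not_ge hab)
  rw [min_eq_left hab]
  rcases lt_trichotomy a 0 with ha | rfl | ha
  · simp [zeroWeight_of_neg M i ha]
  · rcases hab.eq_or_lt with rfl | hb
    · simp [zeroWeight_zero, ← WithZero.coe_mul, genH_idem]
    · simp [zeroWeight_of_pos M i hb]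
  · simp [zeroWeight_of_pos M i ha, zeroWeight_of_pos M i (ha.trans_le hab)]

theorem zeroWeight_braid {I : Type*} {M : CoxeterMatrix I} {i j : I} (h : M i j = 3)
    (a b c : ℝ) :
    zeroWeight M i a * zeroWeight M j b * zeroWeight M i c =
      zeroWeight M j (b + c - min a c) * zeroWeight M i (min a c) *
        zeroWeight M j (a + b - min a c) := by
  rcases lt_or_ge a 0 with ha | ha
  · simp [zeroWeight_of_neg M i ha, zeroWeight_of_neg M i ((min_le_left a c).trans_lt ha)]
  rcases lt_or_ge c 0 with hc | hc
  · simp [zeroWeight_of_neg M i hc, zeroWeight_of_neg M i ((min_le_right a c).trans_lt hc)]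
  have key : zeroWeight M j (b + c - min a c) * zeroWeight M j (a + b - min a c) =
      zeroWeight M j b := by
    rw [zeroWeight_idem]
    congr 1
    rcases le_total a c with hac | hac
    · rw [min_eq_left hac, min_eq_right] <;> linarith
    · rw [min_eq_right hac, min_eq_left] <;> linarith
  rcases ha.eq_or_lt with rfl | ha
  · rcases hc.eq_or_lt with rfl | hc
    · rcases lt_trichotomy b 0 with hb | rfl | hb
      · simp [zeroWeight_of_neg M j hb]
      · simp [zeroWeight_zero, ← WithZero.coe_mul, genH_braid h]
      · simp [zeroWeight_zero, zeroWeight_of_pos M j hb, ← WithZero.coe_mul, genH_idem]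
    · rcases lt_or_ge b 0 with hb | hb
      · simp [zeroWeight_of_neg M j hb, min_eq_left hc.le]
      · simp [min_eq_left hc.le, zeroWeight_of_pos M i hc,
          zeroWeight_of_pos M j (add_pos_of_nonneg_of_pos hb hc)]
  · rcases hc.eq_or_lt with rfl | hc
    · rcases lt_or_ge b 0 with hb | hb
      · simp [zeroWeight_of_neg M j hb, min_eq_right ha.le]
      · simp [min_eq_right ha.le, zeroWeight_of_pos M i ha,
          zeroWeight_of_pos M j (add_pos_of_pos_of_nonneg ha hb)]
    · simp [zeroWeight_of_pos M i ha, zeroWeight_of_pos M i hc,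
        zeroWeight_of_pos M i (lt_min ha hc), key]

/-- The homomorphism from `𝔘(K)` to the 0-Hecke monoid with an absorbing element adjoined that
takes `i^a` to its weight. -/
noncomputable def zeroWeightHom {I : Type*} (M : CoxeterMatrix I) (K : AddSubgroup ℝ) :
    UK M K →* WithZero (Hecke M) :=
  (conGen (UKRel M K)).lift (FreeMonoid.lift fun p : I × K => zeroWeight M p.1 p.2) <| by
    rw [Con.conGen_le]
    intro x y hxy
    rw [Con.ker_rel]
    cases hxy with
    | comm i j h a b => simpa using zeroWeight_comm h a b
    | braid i j h a b c => simpa [coe_kmin] using zeroWeight_braid h a b c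
    | idem i a b => simpa [coe_kmin] using zeroWeight_idem M i a b

theorem zeroWeightHom_genU {I : Type*} (M : CoxeterMatrix I) (K : AddSubgroup ℝ) (i : I) (a : K) :
    zeroWeightHom M K (genU M K i a) = zeroWeight M i a := by
  simp only [zeroWeightHom, genU]
  exact (Con.lift_mk' _ _).trans (FreeMonoid.lift_eval_of _ _)

/-- On products with nonnegative exponents, `zeroWeightHom` computes the zero-subword. -/
theorem zeroWeightHom_prodU {I : Type*} (M : CoxeterMatrix I) {K : AddSubgroup ℝ}
    (ω : List (I × K)) (hω : ∀ p ∈ ω, 0 ≤ (p.2 : ℝ)) :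
    zeroWeightHom M K (prodU M K ω) = (chiRep M ω : WithZero (Hecke M)) := by
  induction ω with
  | nil => exact map_one _
  | cons p ω ih =>
    have hcons : prodU M K (p :: ω) = genU M K p.1 p.2 * prodU M K ω := List.prod_cons
    rw [hcons, map_mul, zeroWeightHom_genU, ih fun q hq => hω q (List.mem_cons_of_mem p hq)]
    rcases (hω p List.mem_cons_self).eq_or_lt with hp | hp
    · simp [← hp, zeroWeight_zero, chiRep, prodH, zeroList]
    · simp [zeroWeight_of_pos M p.1 hp, chiRep, zeroList, hp.ne']

/-- **9(a)** (Lusztig, "Half circles on flag manifolds over a semifield").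
The map `χ_w` is well defined: if two products `i₁^{a₁} ⋯ i_n^{a_n} = j₁^{b₁} ⋯ j_n^{b_n}`
over reduced words of `w` with coefficients in `K₊` are equal in `𝔘(K)`, then their
zero-subwords are equal in the 0-Hecke monoid `𝔘₁`. -/
theorem chi_well_defined
    {I W : Type*} [Finite I] [Nonempty I] [Group W] [Finite W]
    (M : CoxeterMatrix I) (hM : ∀ i j : I, i ≠ j → M i j = 2 ∨ M i j = 3)
    (cs : CoxeterSystem M W)
    (K : AddSubgroup ℝ) (hK : K ≠ ⊥)
    (w : W) (ω ω' : List (I × K))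
    (h : IsRedWord cs w (ω.map Prod.fst)) (h' : IsRedWord cs w (ω'.map Prod.fst))
    (hpos : ∀ p ∈ ω, 0 ≤ (p.2 : ℝ)) (hpos' : ∀ p ∈ ω', 0 ≤ (p.2 : ℝ))
    (heq : prodU M K ω = prodU M K ω') :
    chiRep M ω = chiRep M ω' := by
  exact WithZero.coe_injective <| by
    rw [← zeroWeightHom_prodU M ω hpos, ← zeroWeightHom_prodU M ω' hpos', heq]
end
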